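/- arXiv:2312.04355 — 3 statements merged into one kernel-verified Lean document; each statement's English description precedes it below -/
import Mathlib

section
/- Let S, W₁, …, W_K ∈ ℂ^{n×n} be positive semidefinite matrices and h₁, …, h_K ∈ ℂⁿ be vectors with hₖᴴ Wₖ hₖ ≠ 0 for every k. For each k define Wₖ_opt := (Wₖ hₖ)(Wₖ hₖ)ᴴ / (hₖᴴ Wₖ hₖ), and define S_opt := (∑ₖ Wₖ + S) − ∑ₖ Wₖ_opt. Then S_opt is positive semidefinite, and ∑ₖ Wₖ_opt + S_opt = ∑ₖ Wₖ + S. -/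
open Matrix
open scoped ComplexOrder

/-- The rank-one reconstruction `W_opt := (W h)(W h)ᴴ / (hᴴ W h)`. -/
noncomputable def Wopt {n : ℕ} (W : Matrix (Fin n) (Fin n) ℂ) (h : Fin n → ℂ) :
    Matrix (Fin n) (Fin n) ℂ :=
  (star h ⬝ᵥ W *ᵥ h)⁻¹ • Matrix.vecMulVec (W *ᵥ h) (star (W *ᵥ h))

/-- Subtracting the rank-one reconstruction from `W` leaves the congruence of `W` by
`1 - (hᴴ W h)⁻¹ h (W h)ᴴ`. -/
theorem posSemidef_sub_Wopt {n : ℕ} {W : Matrix (Fin n) (Fin n) ℂ} {h : Fin n → ℂ}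
    (hW : W.PosSemidef) (hne : star h ⬝ᵥ W *ᵥ h ≠ 0) : (W - Wopt W h).PosSemidef := by
  set c := star h ⬝ᵥ W *ᵥ h with hc
  have hstar : star c = c := (IsSelfAdjoint.of_nonneg (hW.dotProduct_mulVec_nonneg h)).star_eq
  have hvec : star h ᵥ* W = star (W *ᵥ h) := by
    rw [star_mulVec, hW.isHermitian.eq]
  have key : W - Wopt W h = (1 - c⁻¹ • vecMulVec h (star (W *ᵥ h)))ᴴ * W *
      (1 - c⁻¹ • vecMulVec h (star (W *ᵥ h))) := by
    have hdot : star (W *ᵥ h) ⬝ᵥ h = c := by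
      rw [← hvec, ← dotProduct_mulVec]
    simp only [conjTranspose_sub, conjTranspose_one, conjTranspose_smul, conjTranspose_vecMulVec,
      star_star, star_inv₀, hstar, sub_mul, mul_sub, one_mul, mul_one, smul_mul_assoc,
      mul_smul_comm, vecMulVec_mul, mul_vecMulVec, hvec, vecMulVec_mulVec, hdot, Wopt, ← hc]
    simp [smul_smul, hne, smul_vecMulVec]
  rw [key]
  exact hW.conjTranspose_mul_mul_same _

/-- The reconstructed sensing covariance `S_opt := (∑ₖ Wₖ + S) − ∑ₖ Wₖ_opt` is positive
semidefinite, and the total covariance is unchanged: `∑ₖ Wₖ_opt + S_opt = ∑ₖ Wₖ + S`. -/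
theorem Sopt_posSemidef_total_cov {n K : ℕ} (S : Matrix (Fin n) (Fin n) ℂ)
    (W : Fin K → Matrix (Fin n) (Fin n) ℂ) (h : Fin K → (Fin n → ℂ))
    (hS : S.PosSemidef) (hW : ∀ k, (W k).PosSemidef)
    (hne : ∀ k, star (h k) ⬝ᵥ (W k) *ᵥ (h k) ≠ 0) :
    (((∑ k, W k) + S) - ∑ k, Wopt (W k) (h k)).PosSemidef ∧
    (∑ k, Wopt (W k) (h k)) + (((∑ k, W k) + S) - ∑ k, Wopt (W k) (h k)) = (∑ k, W k) + S := by
  refine ⟨?_, add_sub_cancel _ _⟩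
  rw [add_sub_right_comm, ← Finset.sum_sub_distrib]
  exact (posSemidef_sum _ fun k _ => posSemidef_sub_Wopt (hW k) (hne k)).add hS
end

section
/- Let Ψ be an m×n complex matrix whose Gram matrix ΨᴴΨ is positive definite, let r ∈ ℂᵐ, define α̂₁ := (ΨᴴΨ)⁻¹ Ψᴴ r, let μ ∈ ℂⁿ be nonzero, and set c := μᴴ(ΨᴴΨ)⁻¹μ (a positive real number). Define α̂₀ := α̂₁ − ((ΨᴴΨ)⁻¹ μ)·(μᴴ α̂₁)/c. Then (i) μᴴ α̂₀ = 0, and (ii) for every α ∈ ℂⁿ with μᴴ α = 0, ‖r − Ψ α̂₀‖² ≤ ‖r − Ψ α‖². -/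
open Matrix
open scoped ComplexOrder

/-- Squared Euclidean norm of a complex vector. -/
def sqnorm {m : ℕ} (v : Fin m → ℂ) : ℝ := ∑ i, Complex.normSq (v i)

/-- The unconstrained least-squares (ML) estimate `α̂₁ := (ΨᴴΨ)⁻¹ Ψᴴ r`. -/
noncomputable def alphaHat1 {m n : ℕ} (Ψ : Matrix (Fin m) (Fin n) ℂ) (r : Fin m → ℂ) :
    Fin n → ℂ :=
  (Ψᴴ * Ψ)⁻¹ *ᵥ (Ψᴴ *ᵥ r)

/-- The constrained ML estimate `α̂₀ := α̂₁ − ((ΨᴴΨ)⁻¹ μ)·(μᴴ α̂₁)/c` with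
`c := μᴴ(ΨᴴΨ)⁻¹μ`. -/
noncomputable def alphaHat0 {m n : ℕ} (Ψ : Matrix (Fin m) (Fin n) ℂ) (r : Fin m → ℂ)
    (μ : Fin n → ℂ) : Fin n → ℂ :=
  alphaHat1 Ψ r -
    ((star μ ⬝ᵥ alphaHat1 Ψ r) / (star μ ⬝ᵥ (Ψᴴ * Ψ)⁻¹ *ᵥ μ)) • ((Ψᴴ * Ψ)⁻¹ *ᵥ μ)

theorem sqnorm_nonneg {m : ℕ} (v : Fin m → ℂ) : 0 ≤ sqnorm v :=
  Finset.sum_nonneg fun i _ => Complex.normSq_nonneg (v i)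

theorem sqnorm_add_of_dotProduct_eq_zero {m : ℕ} {u v : Fin m → ℂ} (h : star u ⬝ᵥ v = 0) :
    sqnorm (u + v) = sqnorm u + sqnorm v := by
  have hre : ∑ i, (u i * (starRingEnd ℂ) (v i)).re = 0 := by
    rw [← Complex.zero_re, ← h, dotProduct, Complex.re_sum]
    refine Finset.sum_congr rfl fun i _ => ?_
    simp
  simp only [sqnorm, Pi.add_apply, Complex.normSq_add, Finset.sum_add_distrib, ← Finset.mul_sum,
    hre, mul_zero, add_zero]

theorem mulVec_alphaHat1 {m n : ℕ} {Ψ : Matrix (Fin m) (Fin n) ℂ} (hΨ : (Ψᴴ * Ψ).PosDef)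
    (r : Fin m → ℂ) : (Ψᴴ * Ψ) *ᵥ alphaHat1 Ψ r = Ψᴴ *ᵥ r := by
  rw [alphaHat1, mulVec_mulVec, mul_nonsing_inv _ ((isUnit_iff_isUnit_det _).mp hΨ.isUnit),
    one_mulVec]

/-- The stationarity condition of the Lagrange multiplier method: the gradient of the
least-squares objective at the constrained estimate is a multiple of `μ`. -/
theorem conjTranspose_mulVec_residual_alphaHat0 {m n : ℕ} {Ψ : Matrix (Fin m) (Fin n) ℂ}
    (hΨ : (Ψᴴ * Ψ).PosDef) (r : Fin m → ℂ) (μ : Fin n → ℂ) :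
    Ψᴴ *ᵥ (r - Ψ *ᵥ alphaHat0 Ψ r μ) =
      ((star μ ⬝ᵥ alphaHat1 Ψ r) / (star μ ⬝ᵥ (Ψᴴ * Ψ)⁻¹ *ᵥ μ)) • μ := by
  have hdet := (isUnit_iff_isUnit_det _).mp hΨ.isUnit
  rw [mulVec_sub, mulVec_mulVec, alphaHat0, mulVec_sub, mulVec_alphaHat1 hΨ, mulVec_smul,
    mulVec_mulVec, mul_nonsing_inv _ hdet, one_mulVec, sub_sub_cancel]

theorem dotProduct_alphaHat0 {m n : ℕ} {Ψ : Matrix (Fin m) (Fin n) ℂ} (hΨ : (Ψᴴ * Ψ).PosDef)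
    (r : Fin m → ℂ) {μ : Fin n → ℂ} (hμ : μ ≠ 0) : star μ ⬝ᵥ alphaHat0 Ψ r μ = 0 := by
  have hc : star μ ⬝ᵥ (Ψᴴ * Ψ)⁻¹ *ᵥ μ ≠ 0 := (hΨ.inv.dotProduct_mulVec_pos hμ).ne'
  rw [alphaHat0, dotProduct_sub, dotProduct_smul, smul_eq_mul, div_mul_cancel₀ _ hc, sub_self]

/-- If `ΨᴴΨ` is positive definite and `μ ≠ 0`, then `α̂₀` satisfies the constraint
`μᴴ α̂₀ = 0` and minimizes the least-squares objective among all `α` with `μᴴ α = 0`. -/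
theorem alphaHat0_constrained_leastSquares {m n : ℕ} (Ψ : Matrix (Fin m) (Fin n) ℂ)
    (hΨ : (Ψᴴ * Ψ).PosDef) (r : Fin m → ℂ) (μ : Fin n → ℂ) (hμ : μ ≠ 0) :
    star μ ⬝ᵥ alphaHat0 Ψ r μ = 0 ∧
    ∀ α : Fin n → ℂ, star μ ⬝ᵥ α = 0 →
      sqnorm (r - Ψ *ᵥ alphaHat0 Ψ r μ) ≤ sqnorm (r - Ψ *ᵥ α) := by
  refine ⟨dotProduct_alphaHat0 hΨ r hμ, fun α hα => ?_⟩
  have horth : star (r - Ψ *ᵥ alphaHat0 Ψ r μ) ⬝ᵥ Ψ *ᵥ (alphaHat0 Ψ r μ - α) = 0 := by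
    rw [dotProduct_mulVec, ← conjTranspose_conjTranspose Ψ, ← star_mulVec,
      conjTranspose_conjTranspose, conjTranspose_mulVec_residual_alphaHat0 hΨ, star_smul,
      smul_dotProduct, dotProduct_sub, dotProduct_alphaHat0 hΨ r hμ, hα, sub_zero, smul_zero]
  have hsplit : r - Ψ *ᵥ α = (r - Ψ *ᵥ alphaHat0 Ψ r μ) + Ψ *ᵥ (alphaHat0 Ψ r μ - α) := by
    rw [mulVec_sub, sub_add_sub_cancel]
  rw [hsplit, sqnorm_add_of_dotProduct_eq_zero horth]
  exact le_add_of_nonneg_right (sqnorm_nonneg _)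
end

section
/- (Proposition 3.) Let S, W₁, …, W_K ∈ ℂ^{n×n} be positive semidefinite and h₁, …, h_K, g ∈ ℂⁿ with hₖᴴ Wₖ hₖ ≠ 0 for every k. Define Wₖ_opt := (Wₖ hₖ)(Wₖ hₖ)ᴴ / (hₖᴴ Wₖ hₖ) and S_opt := (∑ⱼ Wⱼ + S) − ∑ⱼ Wⱼ_opt. Then: (i) each Wₖ_opt is positive semidefinite with rank(Wₖ_opt) = 1; (ii) S_opt is positive semidefinite; (iii) ∑ⱼ Wⱼ_opt + S_opt = ∑ⱼ Wⱼ + S; (iv) for all real Γ > 0 and σ² > 0 and every k, if hₖᴴ( Wₖ − Γ(∑_{j≠k} Wⱼ + S) ) hₖ ≥ Γσ², then hₖᴴ( Wₖ_opt − Γ(∑_{j≠k} Wⱼ_opt + S_opt) ) hₖ ≥ Γσ²; and (v) for every k and every real c, if gᴴ Wₖ g ≤ c then gᴴ Wₖ_opt g ≤ c. -/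
open Matrix
open scoped ComplexOrder

section RankOneReconstruction

variable {n : ℕ} {W : Matrix (Fin n) (Fin n) ℂ} {h : Fin n → ℂ}

theorem Matrix.PosSemidef.wopt (hW : W.PosSemidef) : (Wopt W h).PosSemidef :=
  (posSemidef_vecMulVec_self_star _).smul
    (inv_nonneg_of_nonneg (hW.dotProduct_mulVec_nonneg h))

theorem star_mulVec_dotProduct (hW : W.IsHermitian) (x : Fin n → ℂ) :
    star (W *ᵥ h) ⬝ᵥ x = star h ⬝ᵥ W *ᵥ x := by
  rw [star_mulVec, hW.eq, dotProduct_mulVec]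

theorem Wopt_mulVec_self (hW : W.IsHermitian) (hne : star h ⬝ᵥ W *ᵥ h ≠ 0) :
    Wopt W h *ᵥ h = W *ᵥ h := by
  rw [Wopt, smul_mulVec, vecMulVec_mulVec, star_mulVec_dotProduct hW, op_smul_eq_smul, smul_smul,
    inv_mul_cancel₀ hne, one_smul]

theorem rank_Wopt (hW : W.IsHermitian) (hne : star h ⬝ᵥ W *ᵥ h ≠ 0) : (Wopt W h).rank = 1 := by
  refine le_antisymm ?_ (Nat.one_le_iff_ne_zero.mpr fun h0 => ?_)
  · rw [Wopt, ← smul_vecMulVec]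
    exact rank_vecMulVec_le _ _
  · rw [Matrix.rank, Submodule.finrank_eq_zero, LinearMap.range_eq_bot] at h0
    have hv : W *ᵥ h = 0 := by
      rw [← Wopt_mulVec_self hW hne, ← mulVecLin_apply, h0, LinearMap.zero_apply]
    exact hne (by rw [hv, dotProduct_zero])

/-- The residual is the congruence of `W` by the `W`-orthogonal projection along `h`. -/
theorem Matrix.PosSemidef.sub_wopt (hW : W.PosSemidef) (hne : star h ⬝ᵥ W *ᵥ h ≠ 0) :
    (W - Wopt W h).PosSemidef := by
  set d := star h ⬝ᵥ W *ᵥ h with hd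
  have hdr : star d = d := (hW.dotProduct_mulVec_nonneg h).isSelfAdjoint
  have hvW : vecMulVec (W *ᵥ h) (star h) * W = vecMulVec (W *ᵥ h) (star (W *ᵥ h)) := by
    rw [vecMulVec_mul, star_mulVec, hW.isHermitian.eq]
  have key : (1 - d⁻¹ • vecMulVec h (star (W *ᵥ h)))ᴴ * W *
      (1 - d⁻¹ • vecMulVec h (star (W *ᵥ h))) = W - Wopt W h := by
    rw [conjTranspose_sub, conjTranspose_smul, conjTranspose_vecMulVec, star_star,
      conjTranspose_one, star_inv₀, hdr, sub_mul, smul_mul_assoc, hvW, one_mul, sub_mul, mul_sub,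
      mul_sub, mul_one, mul_one, mul_smul_comm, mul_vecMulVec, Wopt, ← hd, smul_mul_smul_comm,
      vecMulVec_mul_vecMulVec, star_mulVec_dotProduct hW.isHermitian, ← hd, vecMulVec_smul,
      smul_smul, mul_assoc, inv_mul_cancel₀ hne, mul_one, sub_self, sub_zero]
  rw [← key]
  exact hW.conjTranspose_mul_mul_same _

end RankOneReconstruction

/-- Proposition 3: with `Wₖ_opt := (Wₖ hₖ)(Wₖ hₖ)ᴴ / (hₖᴴ Wₖ hₖ)` and
`S_opt := (∑ⱼ Wⱼ + S) − ∑ⱼ Wⱼ_opt`: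
(i) each `Wₖ_opt` is positive semidefinite of rank one;
(ii) `S_opt` is positive semidefinite;
(iii) `∑ⱼ Wⱼ_opt + S_opt = ∑ⱼ Wⱼ + S`;
(iv) the communication SINR constraints are preserved;
(v) the information-eavesdropping SNR constraints are preserved. -/
theorem sdr_tightness {n K : ℕ} (S : Matrix (Fin n) (Fin n) ℂ)
    (W : Fin K → Matrix (Fin n) (Fin n) ℂ) (hvec : Fin K → (Fin n → ℂ)) (g : Fin n → ℂ)
    (hS : S.PosSemidef) (hW : ∀ k, (W k).PosSemidef)
    (hne : ∀ k, star (hvec k) ⬝ᵥ (W k) *ᵥ (hvec k) ≠ 0) :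
    (∀ k, (Wopt (W k) (hvec k)).PosSemidef ∧ (Wopt (W k) (hvec k)).rank = 1) ∧
    (((∑ j, W j) + S) - ∑ j, Wopt (W j) (hvec j)).PosSemidef ∧
    ((∑ j, Wopt (W j) (hvec j)) + (((∑ j, W j) + S) - ∑ j, Wopt (W j) (hvec j)) =
      (∑ j, W j) + S) ∧
    (∀ Γ σ2 : ℝ, 0 < Γ → 0 < σ2 → ∀ k,
      Γ * σ2 ≤ (star (hvec k) ⬝ᵥ
          (W k - (Γ : ℂ) • ((∑ j ∈ Finset.univ.erase k, W j) + S)) *ᵥ (hvec k)).re →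
      Γ * σ2 ≤ (star (hvec k) ⬝ᵥ
          (Wopt (W k) (hvec k) -
            (Γ : ℂ) • ((∑ j ∈ Finset.univ.erase k, Wopt (W j) (hvec j)) +
              (((∑ j, W j) + S) - ∑ j, Wopt (W j) (hvec j)))) *ᵥ (hvec k)).re) ∧
    ∀ (k : Fin K) (c : ℝ),
      (star g ⬝ᵥ (W k) *ᵥ g).re ≤ c → (star g ⬝ᵥ (Wopt (W k) (hvec k)) *ᵥ g).re ≤ c := by
  have hdiff k := (hW k).sub_wopt (hne k)
  refine ⟨fun k => ⟨(hW k).wopt, rank_Wopt (hW k).isHermitian (hne k)⟩, ?_, add_sub_cancel _ _, ?_, ?_⟩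
  · rw [add_sub_right_comm, ← Finset.sum_sub_distrib]
    exact (posSemidef_sum _ fun k _ => hdiff k).add hS
  · intro Γ σ2 _ _ k hk
    have hX : Wopt (W k) (hvec k) -
        (Γ : ℂ) • ((∑ j ∈ Finset.univ.erase k, Wopt (W j) (hvec j)) +
          (((∑ j, W j) + S) - ∑ j, Wopt (W j) (hvec j))) =
        (W k - (Γ : ℂ) • ((∑ j ∈ Finset.univ.erase k, W j) + S)) -
          (1 + (Γ : ℂ)) • (W k - Wopt (W k) (hvec k)) := by
      rw [Finset.sum_erase_eq_sub (Finset.mem_univ k), Finset.sum_erase_eq_sub (Finset.mem_univ k)]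
      module
    rwa [hX, sub_mulVec _ (_ • _), smul_mulVec, sub_mulVec (W k) (Wopt _ _),
      Wopt_mulVec_self (hW k).isHermitian (hne k), sub_self, smul_zero, sub_zero]
  · intro k c hc
    have hnn := (Complex.le_def.mp ((hdiff k).dotProduct_mulVec_nonneg g)).1
    rw [sub_mulVec, dotProduct_sub, Complex.sub_re, Complex.zero_re] at hnn
    linarith
end
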